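/- arXiv:1308.5031 — 2 statements merged into one kernel-verified Lean document; each statement's English description precedes it below -/
import Mathlib

section
/- For transmission T = 0.6 and every α > 0, c₁(α,T)² + erf(√(T/2)·α)² ≤ 1; that is, with two homodyne measurements and the stated binning, no CHSH violation (S = 2√(c₁² + c₂²) > 2) is possible when the line transmission is 60%, consistent with the minimum required transmission of about 0.678. -/
open Real

/-- Error function `erf x = (2/√π)·∫₀ˣ e^{−t²} dt`. -/
noncomputable def erf (x : ℝ) : ℝ :=
  (2 / Real.sqrt π) * ∫ t in (0 : ℝ)..x, Real.exp (-t ^ 2)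

/-- Homodyne binning parameter at transmission `T`: `b = π/(2√2·√T·α)`. -/
noncomputable def bT (α T : ℝ) : ℝ := π / (2 * Real.sqrt 2 * (Real.sqrt T * α))

/-- Homodyne interference coefficient at transmission `T`:
`c₁(α,T) = e^{−(1−T)α²/2}·[(2/√π)·∫_{−b}^{b} e^{−x²} cos(√2 x √T α) dx − e^{−Tα²/2}]`. -/
noncomputable def c1T (α T : ℝ) : ℝ :=
  Real.exp (-(1 - T) * α ^ 2 / 2) *
    ((2 / Real.sqrt π) *
        (∫ x in (-bT α T)..(bT α T),
          Real.exp (-x ^ 2) * Real.cos (Real.sqrt 2 * x * (Real.sqrt T * α)))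
      - Real.exp (-T * α ^ 2 / 2))

lemma aux_cos_le_exp_nonneg {u : ℝ} (h0 : 0 ≤ u) (h1 : u ≤ π / 2) :
    Real.cos u ≤ Real.exp (-(u ^ 2 / 2)) := by
  have hder : ∀ x : ℝ, HasDerivAt (fun x : ℝ => Real.exp (x ^ 2 / 2) * Real.cos x)
      (Real.exp (x ^ 2 / 2) * (x * Real.cos x - Real.sin x)) x := by
    intro x
    have h2 : HasDerivAt (fun x : ℝ => x ^ 2 / 2) x x := by
      have := (hasDerivAt_pow 2 x).div_const 2
      exact this.congr_deriv (by norm_num)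
    have := h2.exp.mul (Real.hasDerivAt_cos x)
    exact this.congr_deriv (by ring)
  have hanti : AntitoneOn (fun x : ℝ => Real.exp (x ^ 2 / 2) * Real.cos x) (Set.Icc 0 (π / 2)) := by
    apply antitoneOn_of_deriv_nonpos (convex_Icc _ _)
    · exact fun x _ => (hder x).continuousAt.continuousWithinAt
    · exact fun x _ => (hder x).differentiableAt.differentiableWithinAt
    · intro x hx
      rw [interior_Icc] at hx
      rw [(hder x).deriv]
      have hc : 0 < Real.cos x := Real.cos_pos_of_mem_Ioo ⟨by linarith [hx.1, Real.pi_pos], hx.2⟩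
      have ht := Real.lt_tan hx.1 hx.2
      rw [Real.tan_eq_sin_div_cos, lt_div_iff₀ hc] at ht
      exact mul_nonpos_of_nonneg_of_nonpos (Real.exp_pos _).le (by linarith)
  have h := hanti (Set.left_mem_Icc.2 (by positivity)) ⟨h0, h1⟩ h0
  simp only [ne_eq, OfNat.ofNat_ne_zero, not_false_eq_true, zero_pow, zero_div, Real.exp_zero,
    Real.cos_zero, mul_one] at h
  rw [Real.exp_neg, ← one_div, le_div_iff₀ (Real.exp_pos _)]
  linarith

lemma aux_cos_le_exp {u : ℝ} (h : |u| ≤ π / 2) :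
    Real.cos u ≤ Real.exp (-(u ^ 2 / 2)) := by
  have := aux_cos_le_exp_nonneg (abs_nonneg u) h
  rwa [Real.cos_abs, sq_abs] at this

/-- Classical identity for the square of the Gaussian integral. -/
lemma aux_gauss_sq (z : ℝ) :
    (∫ t in (0 : ℝ)..z, Real.exp (-t ^ 2)) ^ 2
      + ∫ t in (0 : ℝ)..1, Real.exp (-(z ^ 2 * (1 + t ^ 2))) * (1 + t ^ 2)⁻¹ = π / 4 := by
  have hne : ∀ t : ℝ, (1 + t ^ 2) ≠ 0 := fun t => by positivity
  have hd1 : ∀ x : ℝ, HasDerivAt (fun z : ℝ => ∫ t in (0 : ℝ)..z, Real.exp (-t ^ 2))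
      (Real.exp (-x ^ 2)) x := by
    intro x
    have hc : Continuous fun t : ℝ => Real.exp (-t ^ 2) := by fun_prop
    exact intervalIntegral.integral_hasDerivAt_right (hc.intervalIntegrable _ _)
      (hc.stronglyMeasurableAtFilter _ _) hc.continuousAt
  have hcF : ∀ x : ℝ, Continuous fun t : ℝ =>
      Real.exp (-(x ^ 2 * (1 + t ^ 2))) * (1 + t ^ 2)⁻¹ := by
    intro x
    have : Continuous fun t : ℝ => (1 + t ^ 2)⁻¹ := Continuous.inv₀ (by fun_prop) hne
    fun_prop
  have hd2 : ∀ x : ℝ, HasDerivAt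
      (fun z : ℝ => ∫ t in (0 : ℝ)..1, Real.exp (-(z ^ 2 * (1 + t ^ 2))) * (1 + t ^ 2)⁻¹)
      (∫ t in (0 : ℝ)..1, -2 * x * Real.exp (-(x ^ 2 * (1 + t ^ 2)))) x := by
    intro x
    refine (intervalIntegral.hasDerivAt_integral_of_dominated_loc_of_deriv_le
      (F' := fun x t => -2 * x * Real.exp (-(x ^ 2 * (1 + t ^ 2))))
      (bound := fun _ => 2 * (|x| + 1))
      (Metric.ball_mem_nhds x one_pos) ?_ ?_ ?_ ?_ ?_ ?_).2
    · exact Filter.Eventually.of_forall fun y => (hcF y).aestronglyMeasurable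
    · exact (hcF x).intervalIntegrable _ _
    · exact Continuous.aestronglyMeasurable (by fun_prop)
    · refine Filter.Eventually.of_forall fun t _ y hy => ?_
      rw [Metric.mem_ball, Real.dist_eq] at hy
      have h1 : |y| ≤ |x| + 1 := by
        have := abs_sub_abs_le_abs_sub y x
        linarith
      have h2 : Real.exp (-(y ^ 2 * (1 + t ^ 2))) ≤ 1 := by
        rw [Real.exp_le_one_iff]
        have : 0 ≤ y ^ 2 * (1 + t ^ 2) := by positivity
        linarith
      rw [Real.norm_eq_abs, abs_mul, abs_mul, abs_of_pos (Real.exp_pos _)]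
      norm_num
      nlinarith [abs_nonneg y, Real.exp_pos (-(y ^ 2 * (1 + t ^ 2)))]
    · exact intervalIntegrable_const
    · refine Filter.Eventually.of_forall fun t _ y _ => ?_
      have h1 : HasDerivAt (fun y : ℝ => -(y ^ 2 * (1 + t ^ 2))) (-(2 * y * (1 + t ^ 2))) y := by
        have := ((hasDerivAt_pow 2 y).mul_const (1 + t ^ 2)).neg
        exact this.congr_deriv (by norm_num)
      have h2 := h1.exp.mul_const ((1 + t ^ 2)⁻¹)
      refine h2.congr_deriv ?_
      have := hne t
      field_simp
  have hval : ∀ x : ℝ, (∫ t in (0 : ℝ)..1, -2 * x * Real.exp (-(x ^ 2 * (1 + t ^ 2))))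
      = -2 * Real.exp (-x ^ 2) * ∫ t in (0 : ℝ)..x, Real.exp (-t ^ 2) := by
    intro x
    have h := intervalIntegral.mul_integral_comp_mul_left (a := 0) (b := 1)
      (f := fun t : ℝ => Real.exp (-t ^ 2)) x
    rw [mul_zero, mul_one] at h
    rw [← h, ← intervalIntegral.integral_const_mul, ← intervalIntegral.integral_const_mul]
    refine intervalIntegral.integral_congr fun t _ => ?_
    have : Real.exp (-(x ^ 2 * (1 + t ^ 2))) = Real.exp (-x ^ 2) * Real.exp (-(x * t) ^ 2) := by
      rw [← Real.exp_add]; congr 1; ring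
    simp only [this]
    ring
  have hG : ∀ x : ℝ, HasDerivAt (fun z : ℝ => (∫ t in (0 : ℝ)..z, Real.exp (-t ^ 2)) ^ 2
      + ∫ t in (0 : ℝ)..1, Real.exp (-(z ^ 2 * (1 + t ^ 2))) * (1 + t ^ 2)⁻¹) 0 x := by
    intro x
    have := ((hd1 x).pow 2).add (hd2 x)
    rw [hval x] at this
    refine this.congr_deriv ?_
    norm_num
    ring
  have hconst := is_const_of_deriv_eq_zero (fun x => (hG x).differentiableAt)
    (fun x => (hG x).deriv) z 0
  rw [hconst]
  simp

lemma aux_erf_sq (z : ℝ) : (erf z) ^ 2 ≤ 1 - Real.exp (-(4 / π * z ^ 2)) := by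
  have hp := Real.pi_pos
  have hid := aux_gauss_sq z
  have hinv : Continuous fun t : ℝ => (1 + t ^ 2)⁻¹ :=
    Continuous.inv₀ (by fun_prop) (fun t => by positivity)
  have hJ : Real.exp (-(4 / π * z ^ 2)) * (π / 4) ≤
      ∫ t in (0 : ℝ)..1, Real.exp (-(z ^ 2 * (1 + t ^ 2))) * (1 + t ^ 2)⁻¹ := by
    set m := Real.exp (-(4 / π * z ^ 2)) with hm
    have h1 : (∫ t in (0 : ℝ)..1, (m * (1 + 4 / π * z ^ 2) * (1 + t ^ 2)⁻¹ - m * z ^ 2))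
        = m * (π / 4) := by
      rw [intervalIntegral.integral_sub (Continuous.intervalIntegrable (by fun_prop) _ _)
        intervalIntegrable_const, intervalIntegral.integral_const_mul, integral_inv_one_add_sq]
      simp
      field_simp
      ring
    rw [← h1]
    apply intervalIntegral.integral_mono_on zero_le_one
      (Continuous.intervalIntegrable (by fun_prop) _ _)
      (Continuous.intervalIntegrable (by fun_prop) _ _)
    intro t _
    have hpos : 0 < 1 + t ^ 2 := by positivity
    have h2 : Real.exp (-(z ^ 2 * (1 + t ^ 2))) =
        m * Real.exp (4 / π * z ^ 2 - z ^ 2 * (1 + t ^ 2)) := by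
      rw [hm, ← Real.exp_add]; congr 1; ring
    have h3 := Real.add_one_le_exp (4 / π * z ^ 2 - z ^ 2 * (1 + t ^ 2))
    have h4 : m * (1 + 4 / π * z ^ 2) * (1 + t ^ 2)⁻¹ - m * z ^ 2 =
        m * (4 / π * z ^ 2 - z ^ 2 * (1 + t ^ 2) + 1) * (1 + t ^ 2)⁻¹ := by
      field_simp
      ring
    rw [h4, h2]
    have hm0 : 0 < m := Real.exp_pos _
    gcongr
  unfold erf
  rw [mul_pow, div_pow, Real.sq_sqrt hp.le]
  have h5 : (∫ t in (0 : ℝ)..z, Real.exp (-t ^ 2)) ^ 2 ≤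
      π / 4 * (1 - Real.exp (-(4 / π * z ^ 2))) := by linarith
  calc _ ≤ 2 ^ 2 / π * (π / 4 * (1 - Real.exp (-(4 / π * z ^ 2)))) := by gcongr
    _ = _ := by field_simp; norm_num

lemma aux_elem {w : ℝ} (hw : 0 ≤ w) : 2 / √(1 + 2 * w) ≤ 1 + Real.exp (-w) := by
  have he := Real.exp_pos (-w)
  rw [div_le_iff₀ (by positivity)]
  have key : 4 ≤ (1 + Real.exp (-w)) ^ 2 * (1 + 2 * w) := by
    rcases le_total w (1 / 2) with h | h
    · have h1 : 1 - w ≤ Real.exp (-w) := by linarith [Real.add_one_le_exp (-w)]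
      have h2 : (2 - w) ^ 2 ≤ (1 + Real.exp (-w)) ^ 2 := by
        apply pow_le_pow_left₀ <;> linarith
      have h3 : (2 - w) ^ 2 * (1 + 2 * w) ≤ (1 + Real.exp (-w)) ^ 2 * (1 + 2 * w) := by gcongr
      nlinarith [mul_nonneg hw hw, mul_nonneg hw (sub_nonneg.2 h), pow_nonneg hw 3]
    · rcases le_total w (3 / 2) with h' | h'
      · have h1 : (1 - w / 2) ^ 2 ≤ Real.exp (-w) := by
          have h2 := Real.add_one_le_exp (-w / 2)
          have h3 : Real.exp (-w) = Real.exp (-w / 2) ^ 2 := by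
            rw [← Real.exp_nat_mul]; congr 1; push_cast; ring
          rw [h3]
          apply pow_le_pow_left₀ <;> linarith
        have h2 : 1 + 2 * (1 - w / 2) ^ 2 ≤ (1 + Real.exp (-w)) ^ 2 := by nlinarith
        have h3 : (1 + 2 * (1 - w / 2) ^ 2) * (1 + 2 * w)
          ≤ (1 + Real.exp (-w)) ^ 2 * (1 + 2 * w) := by gcongr
        nlinarith [mul_nonneg (sub_nonneg.2 h) (sub_nonneg.2 h'), mul_nonneg (mul_nonneg (sub_nonneg.2 h) (sub_nonneg.2 h')) hw, sq_nonneg (w - 1), mul_nonneg hw (sq_nonneg (w - 1)), mul_nonneg hw (sq_nonneg (w - 5 / 4))]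
      · nlinarith
  have h6 : (2 : ℝ) ^ 2 ≤ ((1 + Real.exp (-w)) * √(1 + 2 * w)) ^ 2 := by
    rw [mul_pow, Real.sq_sqrt (by positivity)]
    linarith
  exact le_of_sq_le_sq h6 (by positivity)

lemma aux_g {y : ℝ} (hy : 0 < y) :
    |(2 / √π) * (∫ x in (-(π / (2 * √2 * y)))..(π / (2 * √2 * y)),
          Real.exp (-x ^ 2) * Real.cos (√2 * x * y)) - Real.exp (-(y ^ 2 / 2))| ≤ 1 := by
  have hp := Real.pi_pos
  set b := π / (2 * √2 * y) with hb
  have hb0 : 0 < b := by positivity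
  have hu : ∀ x ∈ Set.Icc (-b) b, |√2 * x * y| ≤ π / 2 := by
    intro x hx
    have h1 : |x| ≤ b := abs_le.2 hx
    rw [abs_mul, abs_mul, abs_of_pos hy, abs_of_pos (by positivity : (0 : ℝ) < √2)]
    calc √2 * |x| * y ≤ √2 * b * y := by gcongr
      _ = π / 2 := by rw [hb]; field_simp
  have hlow : 0 ≤ ∫ x in (-b)..b, Real.exp (-x ^ 2) * Real.cos (√2 * x * y) := by
    apply intervalIntegral.integral_nonneg (by linarith)
    intro x hx
    have := abs_le.1 (hu x hx)
    exact mul_nonneg (Real.exp_pos _).le (Real.cos_nonneg_of_mem_Icc ⟨by linarith, this.2⟩)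
  have hupp : ∫ x in (-b)..b, Real.exp (-x ^ 2) * Real.cos (√2 * x * y) ≤ √(π / (1 + y ^ 2)) := by
    rw [← integral_gaussian]
    have hi := integrable_exp_neg_mul_sq (show (0 : ℝ) < 1 + y ^ 2 by positivity)
    calc _ ≤ ∫ x in (-b)..b, Real.exp (-(1 + y ^ 2) * x ^ 2) := by
          apply intervalIntegral.integral_mono_on (by linarith)
            (Continuous.intervalIntegrable (by fun_prop) _ _)
            (Continuous.intervalIntegrable (by fun_prop) _ _)
          intro x hx
          have h1 := aux_cos_le_exp (hu x hx)
          have h2 : Real.exp (-(1 + y ^ 2) * x ^ 2) =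
              Real.exp (-x ^ 2) * Real.exp (-((√2 * x * y) ^ 2 / 2)) := by
            rw [← Real.exp_add, mul_pow, mul_pow, Real.sq_sqrt (by norm_num)]
            congr 1; ring
          rw [h2]
          gcongr
      _ ≤ _ := by
          rw [intervalIntegral.integral_of_le (by linarith)]
          exact MeasureTheory.setIntegral_le_integral hi
            (Filter.Eventually.of_forall fun x => (Real.exp_pos _).le)
  have hel := aux_elem (show 0 ≤ y ^ 2 / 2 by positivity)
  have hE1 : Real.exp (-(y ^ 2 / 2)) ≤ 1 := by
    rw [Real.exp_le_one_iff]
    have : 0 ≤ y ^ 2 / 2 := by positivity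
    linarith
  have h7 : 2 / √π * √(π / (1 + y ^ 2)) = 2 / √(1 + 2 * (y ^ 2 / 2)) := by
    rw [Real.sqrt_div hp.le, show 1 + 2 * (y ^ 2 / 2) = 1 + y ^ 2 by ring]
    have : √π ≠ 0 := by positivity
    field_simp
  have h8 : 2 / √π * (∫ x in (-b)..b, Real.exp (-x ^ 2) * Real.cos (√2 * x * y)) ≤
      2 / √π * √(π / (1 + y ^ 2)) := by gcongr
  have h9 : 0 ≤ 2 / √π * (∫ x in (-b)..b, Real.exp (-x ^ 2) * Real.cos (√2 * x * y)) := by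
    positivity
  rw [abs_le]
  constructor <;> linarith

/-- At transmission `T = 0.6`, for every `α > 0`, `c₁(α,T)² + erf(√(T/2)·α)² ≤ 1`:
with two homodyne measurements and the stated binning no CHSH violation is possible at 60%
line transmission, consistent with the minimum required transmission of about 0.678. -/
theorem no_two_homodyne_violation_at_T_0_6 :
    ∀ α > (0 : ℝ),
      (c1T α 0.6) ^ 2 + (erf (Real.sqrt (0.6 / 2) * α)) ^ 2 ≤ 1 := by
  intro α hα
  have hp := Real.pi_gt_three
  have hy : 0 < √(0.6 : ℝ) * α := by positivity
  have hg := aux_g hy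
  have hy2 : (√(0.6 : ℝ) * α) ^ 2 = 0.6 * α ^ 2 := by
    rw [mul_pow, Real.sq_sqrt (by norm_num)]
  rw [hy2, show -(0.6 * α ^ 2 / 2) = -0.6 * α ^ 2 / 2 by ring] at hg
  have he := aux_erf_sq (√(0.6 / 2) * α)
  rw [mul_pow, Real.sq_sqrt (by norm_num)] at he
  have hc : (c1T α 0.6) ^ 2 ≤ Real.exp (-(1 - 0.6) * α ^ 2 / 2) ^ 2 := by
    unfold c1T bT
    rw [mul_pow]
    exact mul_le_of_le_one_right (by positivity) ((sq_le_one_iff_abs_le_one _).2 hg)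
  have hee : Real.exp (-(1 - 0.6) * α ^ 2 / 2) ^ 2 ≤
      Real.exp (-(4 / π * (0.6 / 2 * α ^ 2))) := by
    rw [← Real.exp_nat_mul]
    apply Real.exp_le_exp.2
    have h4 : 4 / π ≤ 4 / 3 := by gcongr
    push_cast
    nlinarith [mul_le_mul_of_nonneg_right h4 (sq_nonneg α)]
  linarith
end

section
/- For perfect transmission T = 1 and atomic detection efficiency η_a = 0.8, for every α > 0 and every ν ∈ ℝ, 0.8·√(c₁(α,1)²·sin²(2ν) + erf(α/√2)²) + 0.2·erf(α/√2)·cos(2ν) ≤ 1; that is, with two homodyne measurements, no CHSH violation is possible if the atomic detection efficiency is 80%, consistent with the required minimum atomic efficiency of about 0.817. -/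
open Real

lemma exp_neg_lb {x : ℝ} (h0 : 0 ≤ x) (h1 : x ≤ 1) :
    1 - x + x ^ 2 / 2 - x ^ 3 / 6 + x ^ 4 / 24 - x ^ 5 / 100 ≤ Real.exp (-x) := by
  have h := Real.exp_bound (x := -x) (by rw [abs_neg, abs_of_nonneg h0]; exact h1)
    (n := 5) (by norm_num)
  rw [abs_neg, abs_of_nonneg h0] at h
  simp [Finset.sum_range_succ, Nat.factorial] at h
  have := (abs_le.mp h).1
  nlinarith [this]

lemma exp_neg_num {y ρ : ℝ} (h0 : 0 ≤ y) (h1 : y ≤ 8)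
    (hp : 0 ≤ 1 - y/8 + (y/8) ^ 2 / 2 - (y/8) ^ 3 / 6 + (y/8) ^ 4 / 24 - (y/8) ^ 5 / 100)
    (h : ρ ≤ (1 - y/8 + (y/8) ^ 2 / 2 - (y/8) ^ 3 / 6 + (y/8) ^ 4 / 24 - (y/8) ^ 5 / 100) ^ 8) :
    ρ ≤ Real.exp (-y) := by
  have e : Real.exp (-y) = (Real.exp (-(y/8))) ^ 8 := by
    rw [← Real.exp_nat_mul]; congr 1; push_cast; ring
  rw [e]
  exact h.trans (pow_le_pow_left₀ hp (exp_neg_lb (by linarith) (by linarith)) 8)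

lemma exp_tangent {y y0 ρ : ℝ} (h : ρ ≤ Real.exp (-y0)) (hy : y ≤ y0 + 1) :
    ρ * (1 - (y - y0)) ≤ Real.exp (-y) := by
  have e : Real.exp (-y) = Real.exp (-y0) * Real.exp (-(y - y0)) := by
    rw [← Real.exp_add]; congr 1; ring
  rw [e]
  have h1 := Real.one_sub_le_exp_neg (y - y0)
  have h2 := Real.exp_pos (-y0)
  nlinarith [mul_le_mul_of_nonneg_right h (by linarith : 0 ≤ 1 - (y - y0)),
    mul_le_mul_of_nonneg_left h1 h2.le]

lemma inv_le_amgm {α a0 : ℝ} (hα : 0 < α) (ha : 0 < a0) :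
    1 / α ≤ (1 / a0 + a0 / α ^ 2) / 2 := by
  have : (1 / a0 + a0 / α ^ 2) / 2 - 1 / α = (α - a0) ^ 2 / (2 * a0 * α ^ 2) := by
    field_simp; ring
  have h2 : 0 ≤ (α - a0) ^ 2 / (2 * a0 * α ^ 2) := by positivity
  linarith

lemma piece {α a0 w0 ρ₁ ρ₂ : ℝ} (hα : 0 < α) (hw1 : 1 ≤ α ^ 2) (ha : 0 < a0)
    (h1 : ρ₁ ≤ Real.exp (-(8 / 25 * w0))) (h2 : ρ₂ ≤ Real.exp (-(w0 / 2)))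
    (hy : α ^ 2 ≤ w0 + 2)
    (hP : 1.5958 * (α ^ 2 + a0 ^ 2) * ((α ^ 2) ^ 2 - 0.2337 * α ^ 2 + 0.06) ≤
      2 * a0 * (α ^ 2) ^ 3 * (1 / 2 + 5 / 8 * (ρ₁ * (1 - (8 / 25 * α ^ 2 - 8 / 25 * w0)))
        + ρ₂ * (1 - (α ^ 2 / 2 - w0 / 2)))) :
    1.5958 / α * (1 - 0.2337 / α ^ 2 + 0.06 / (α ^ 2) ^ 2) ≤
      1 / 2 + 5 / 8 * Real.exp (-(8 / 25 * α ^ 2)) + Real.exp (-(α ^ 2 / 2)) := by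
  have e1 := exp_tangent (y := 8 / 25 * α ^ 2) h1 (by linarith)
  have e2 := exp_tangent (y := α ^ 2 / 2) h2 (by linarith)
  have h3 := inv_le_amgm hα ha
  generalize α ^ 2 = w at *
  have hw : 0 < w := by linarith
  have hpos : 0 ≤ 1 - 0.2337 / w + 0.06 / w ^ 2 := by
    have : 1 - 0.2337 / w + 0.06 / w ^ 2 = (w ^ 2 - 0.2337 * w + 0.06) / w ^ 2 := by
      field_simp
    rw [this]
    apply div_nonneg _ (by positivity)
    nlinarith
  have h4 : 1.5958 / α * (1 - 0.2337 / w + 0.06 / w ^ 2) ≤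
      1.5958 * ((1 / a0 + a0 / w) / 2) * (1 - 0.2337 / w + 0.06 / w ^ 2) := by
    apply mul_le_mul_of_nonneg_right _ hpos
    rw [div_eq_mul_one_div]
    linarith
  have h5 : 1.5958 * ((1 / a0 + a0 / w) / 2) * (1 - 0.2337 / w + 0.06 / w ^ 2) =
      1.5958 * (w + a0 ^ 2) * (w ^ 2 - 0.2337 * w + 0.06) / (2 * a0 * w ^ 3) := by
    field_simp
  have h6 : 1.5958 * (w + a0 ^ 2) * (w ^ 2 - 0.2337 * w + 0.06) / (2 * a0 * w ^ 3) ≤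
     (1 / 2 + 5 / 8 * (ρ₁ * (1 - (8 / 25 * w - 8 / 25 * w0)))
        + ρ₂ * (1 - (w / 2 - w0 / 2))) := by
    rw [div_le_iff₀ (by positivity)]
    linarith
  linarith

lemma bern4 {w l r : ℝ} (h1 : l ≤ w) (h2 : w ≤ r) :
    0 ≤ (w-l)^4 ∧ 0 ≤ (w-l)^3*(r-w) ∧ 0 ≤ (w-l)^2*(r-w)^2 ∧ 0 ≤ (w-l)*(r-w)^3 ∧ 0 ≤ (r-w)^4 := by
  have := sub_nonneg.2 h1
  have := sub_nonneg.2 h2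
  refine ⟨?_, ?_, ?_, ?_, ?_⟩ <;> positivity

lemma ineqB {α : ℝ} (hα : 0 < α) (hw1 : 1 ≤ α ^ 2) :
    1.5958 / α * (1 - 0.2337 / α ^ 2 + 0.06 / (α ^ 2) ^ 2) ≤
      1 / 2 + 5 / 8 * Real.exp (-(8 / 25 * α ^ 2)) + Real.exp (-(α ^ 2 / 2)) := by
  rcases le_or_gt (α ^ 2) 2.5 with h' | h'
  · refine piece (a0 := 1.3) (w0 := 1.7) (ρ₁ := 0.5804) (ρ₂ := 0.4274) hα hw1 (by norm_num)
      (exp_neg_num (by norm_num) (by norm_num) (by norm_num) (by norm_num))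
      (exp_neg_num (by norm_num) (by norm_num) (by norm_num) (by norm_num)) (by linarith) ?_
    obtain ⟨b0, b1, b2, b3, b4⟩ := bern4 hw1 h'
    nlinarith [b0, b1, b2, b3, b4]
  have h := h'
  clear h'
  rcases le_or_gt (α ^ 2) 4 with h' | h'
  · refine piece (a0 := 1.8) (w0 := 3.25) (ρ₁ := 0.3534) (ρ₂ := 0.1969) hα hw1 (by norm_num)
      (exp_neg_num (by norm_num) (by norm_num) (by norm_num) (by norm_num))
      (exp_neg_num (by norm_num) (by norm_num) (by norm_num) (by norm_num)) (by linarith) ?_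
    obtain ⟨b0, b1, b2, b3, b4⟩ := bern4 h.le h'
    nlinarith [b0, b1, b2, b3, b4]
  replace h := h'
  clear h'
  rcases le_or_gt (α ^ 2) 5.4 with h' | h'
  · refine piece (a0 := 2.18) (w0 := 4.75) (ρ₁ := 0.2187) (ρ₂ := 0.093) hα hw1 (by norm_num)
      (exp_neg_num (by norm_num) (by norm_num) (by norm_num) (by norm_num))
      (exp_neg_num (by norm_num) (by norm_num) (by norm_num) (by norm_num)) (by linarith) ?_
    obtain ⟨b0, b1, b2, b3, b4⟩ := bern4 h.le h'
    nlinarith [b0, b1, b2, b3, b4]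
  replace h := h'
  clear h'
  rcases le_or_gt (α ^ 2) 6.8 with h' | h'
  · refine piece (a0 := 2.47) (w0 := 6.1) (ρ₁ := 0.1419) (ρ₂ := 0.0473) hα hw1 (by norm_num)
      (exp_neg_num (by norm_num) (by norm_num) (by norm_num) (by norm_num))
      (exp_neg_num (by norm_num) (by norm_num) (by norm_num) (by norm_num)) (by linarith) ?_
    obtain ⟨b0, b1, b2, b3, b4⟩ := bern4 h.le h'
    nlinarith [b0, b1, b2, b3, b4]
  replace h := h'
  clear h'
  rcases le_or_gt (α ^ 2) 8.4 with h' | h'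
  · refine piece (a0 := 2.74) (w0 := 7.5) (ρ₁ := 0.0907) (ρ₂ := 0.0235) hα hw1 (by norm_num)
      (exp_neg_num (by norm_num) (by norm_num) (by norm_num) (by norm_num))
      (exp_neg_num (by norm_num) (by norm_num) (by norm_num) (by norm_num)) (by linarith) ?_
    obtain ⟨b0, b1, b2, b3, b4⟩ := bern4 h.le h'
    nlinarith [b0, b1, b2, b3, b4]
  replace h := h'
  clear h'
  rcases le_or_gt (α ^ 2) 10.4 with h' | h'
  · refine piece (a0 := 3.05) (w0 := 9.3) (ρ₁ := 0.0509) (ρ₂ := 0.0095) hα hw1 (by norm_num)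
      (exp_neg_num (by norm_num) (by norm_num) (by norm_num) (by norm_num))
      (exp_neg_num (by norm_num) (by norm_num) (by norm_num) (by norm_num)) (by linarith) ?_
    obtain ⟨b0, b1, b2, b3, b4⟩ := bern4 h.le h'
    nlinarith [b0, b1, b2, b3, b4]
  have e1 := Real.exp_pos (-(8 / 25 * α ^ 2))
  have e2 := Real.exp_pos (-(α ^ 2 / 2))
  have h1 : (3.2 : ℝ) ≤ α := by nlinarith
  have h2 : 1.5958 / α ≤ 1 / 2 := by
    rw [div_le_iff₀ hα]; linarith
  have h3 : 1 - 0.2337 / α ^ 2 + 0.06 / (α ^ 2) ^ 2 ≤ 1 := by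
    have : 1 - 0.2337 / α ^ 2 + 0.06 / (α ^ 2) ^ 2 = 1 - (0.2337 * α ^ 2 - 0.06) / (α ^ 2) ^ 2 := by
      field_simp
      ring
    rw [this]
    have : 0 ≤ (0.2337 * α ^ 2 - 0.06) / (α ^ 2) ^ 2 := by
      apply div_nonneg _ (by positivity)
      linarith
    linarith
  have h4 : 0 ≤ 1.5958 / α := by positivity
  nlinarith [mul_le_mul_of_nonneg_left h3 h4]

lemma hasDerivAt_J (x : ℝ) :
    HasDerivAt (fun x : ℝ => ∫ t in (0:ℝ)..1, Real.exp (-(x ^ 2 * (1 + t ^ 2))) / (1 + t ^ 2))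
      (∫ t in (0:ℝ)..1, -2 * x * Real.exp (-(x ^ 2 * (1 + t ^ 2)))) x := by
  have hne : ∀ t : ℝ, 1 + t ^ 2 ≠ 0 := fun t => by positivity
  refine (intervalIntegral.hasDerivAt_integral_of_dominated_loc_of_deriv_le
    (s := Metric.ball x 1) (bound := fun _ => 2 * (|x| + 1))
    (F' := fun x t => -2 * x * Real.exp (-(x ^ 2 * (1 + t ^ 2))))
    (Metric.ball_mem_nhds x one_pos) ?_ ?_ ?_ ?_ ?_ ?_).2
  · refine Filter.Eventually.of_forall fun y => Continuous.aestronglyMeasurable ?_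
    exact Continuous.div (by fun_prop) (by fun_prop) hne
  · apply Continuous.intervalIntegrable
    exact Continuous.div (by fun_prop) (by fun_prop) hne
  · exact Continuous.aestronglyMeasurable (by fun_prop)
  · refine Filter.Eventually.of_forall fun t _ y hy => ?_
    have h1 : |y| ≤ |x| + 1 := by
      have h := Metric.mem_ball.1 hy
      rw [Real.dist_eq] at h
      have := abs_sub_abs_le_abs_sub y x
      linarith
    have h2 : Real.exp (-(y ^ 2 * (1 + t ^ 2))) ≤ 1 :=
      Real.exp_le_one_iff.2 (neg_nonpos.2 (by positivity))
    rw [Real.norm_eq_abs, abs_mul, abs_mul, abs_of_pos (Real.exp_pos _)]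
    norm_num
    nlinarith [abs_nonneg y, Real.exp_pos (-(y ^ 2 * (1 + t ^ 2)))]
  · exact Continuous.intervalIntegrable (by fun_prop) _ _
  · refine Filter.Eventually.of_forall fun t _ y hy => ?_
    have h1 : HasDerivAt (fun y : ℝ => -(y ^ 2 * (1 + t ^ 2))) (-(2 * y * (1 + t ^ 2))) y := by
      refine (((hasDerivAt_pow 2 y).mul_const (1 + t ^ 2)).fun_neg).congr_deriv ?_
      norm_num
    have h2 := h1.exp.div_const (1 + t ^ 2)
    refine h2.congr_deriv ?_
    have := hne t
    field_simp

lemma I_sq_add_J (x : ℝ) :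
    (∫ t in (0 : ℝ)..x, Real.exp (-t ^ 2)) ^ 2 +
      (∫ t in (0:ℝ)..1, Real.exp (-(x ^ 2 * (1 + t ^ 2))) / (1 + t ^ 2)) = π / 4 := by
  have hI : ∀ x : ℝ, HasDerivAt (fun x : ℝ => ∫ t in (0 : ℝ)..x, Real.exp (-t ^ 2))
      (Real.exp (-x ^ 2)) x := fun x =>
    intervalIntegral.integral_hasDerivAt_right
      (Continuous.intervalIntegrable (by fun_prop) _ _)
      (Continuous.stronglyMeasurableAtFilter (by fun_prop) _ _) (by fun_prop)
  have hD : ∀ x : ℝ, HasDerivAt (fun x : ℝ => (∫ t in (0 : ℝ)..x, Real.exp (-t ^ 2)) ^ 2 +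
      (∫ t in (0:ℝ)..1, Real.exp (-(x ^ 2 * (1 + t ^ 2))) / (1 + t ^ 2))) 0 x := by
    intro x
    have h := ((hI x).pow 2).add (hasDerivAt_J x)
    refine h.congr_deriv ?_
    have h1 : (∫ t in (0:ℝ)..1, -2 * x * Real.exp (-(x ^ 2 * (1 + t ^ 2)))) =
        -2 * Real.exp (-x ^ 2) * (x * ∫ t in (0:ℝ)..1, Real.exp (-(x * t) ^ 2)) := by
      rw [← mul_assoc, ← intervalIntegral.integral_const_mul]
      congr 1
      funext t
      have : Real.exp (-(x ^ 2 * (1 + t ^ 2))) = Real.exp (-x ^ 2) * Real.exp (-(x * t) ^ 2) := by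
        rw [← Real.exp_add]; congr 1; ring
      rw [this]; ring
    have h2 := intervalIntegral.mul_integral_comp_mul_left (a := 0) (b := 1)
      (f := fun t => Real.exp (-t ^ 2)) x
    rw [h1, h2]
    simp
    ring
  have hc := is_const_of_deriv_eq_zero (fun y => (hD y).differentiableAt)
    (fun y => (hD y).deriv) x 0
  rw [hc]
  simp

lemma polya (x : ℝ) : (4 / π) * (∫ t in (0 : ℝ)..x, Real.exp (-t ^ 2)) ^ 2 ≤
    1 - Real.exp (-(4 * x ^ 2 / π)) := by
  have hne : ∀ t : ℝ, 1 + t ^ 2 ≠ 0 := fun t => by positivity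
  have h := I_sq_add_J x
  have hpi := Real.pi_pos
  set c := Real.exp (-(4 * x ^ 2 / π)) with hc
  have hJ : c * (1 + 4 * x ^ 2 / π) * (π / 4) - c * x ^ 2 ≤
      ∫ t in (0:ℝ)..1, Real.exp (-(x ^ 2 * (1 + t ^ 2))) / (1 + t ^ 2) := by
    have e : (∫ t in (0:ℝ)..1, (c * (1 + 4 * x ^ 2 / π) * (1 / (1 + t ^ 2)) - c * x ^ 2)) =
        c * (1 + 4 * x ^ 2 / π) * (π / 4) - c * x ^ 2 := by
      rw [intervalIntegral.integral_sub, intervalIntegral.integral_const_mul,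
        integral_one_div_one_add_sq]
      · simp
      · apply Continuous.intervalIntegrable
        exact continuous_const.mul (Continuous.div (by fun_prop) (by fun_prop) hne)
      · simp
    rw [← e]
    apply intervalIntegral.integral_mono_on zero_le_one
    · apply Continuous.intervalIntegrable
      exact (continuous_const.mul (Continuous.div (by fun_prop) (by fun_prop) hne)).sub
        continuous_const
    · apply Continuous.intervalIntegrable
      exact Continuous.div (by fun_prop) (by fun_prop) hne
    · intro t _
      have hp : 0 < 1 + t ^ 2 := by positivity
      rw [le_div_iff₀ hp]
      have h1 : Real.exp (-(x ^ 2 * (1 + t ^ 2))) =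
          c * Real.exp (4 * x ^ 2 / π - x ^ 2 * (1 + t ^ 2)) := by
        rw [hc, ← Real.exp_add]; congr 1; ring
      rw [h1]
      have h2 := Real.add_one_le_exp (4 * x ^ 2 / π - x ^ 2 * (1 + t ^ 2))
      have h3 : (c * (1 + 4 * x ^ 2 / π) * (1 / (1 + t ^ 2)) - c * x ^ 2) * (1 + t ^ 2) =
          c * (4 * x ^ 2 / π - x ^ 2 * (1 + t ^ 2) + 1) := by
        generalize 4 * x ^ 2 / π = y
        field_simp
        ring
      rw [h3]
      exact mul_le_mul_of_nonneg_left h2 (Real.exp_pos _).le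
  have h4 : c * (1 + 4 * x ^ 2 / π) * (π / 4) - c * x ^ 2 = c * (π / 4) := by
    field_simp
    ring
  rw [h4] at hJ
  have h5 : (∫ t in (0 : ℝ)..x, Real.exp (-t ^ 2)) ^ 2 ≤ (1 - c) * (π / 4) := by linarith
  calc _ ≤ (4 / π) * ((1 - c) * (π / 4)) := mul_le_mul_of_nonneg_left h5 (by positivity)
    _ = 1 - c := by field_simp

lemma algebra_final {C E Q s c : ℝ} (hQ0 : 0 ≤ Q) (hE : E ^ 2 ≤ 1 - Q ^ 2)
    (hC : |C| ≤ 1 / 2 + 5 / 8 * Q) (hsc : s ^ 2 + c ^ 2 = 1) :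
    0.8 * Real.sqrt (C ^ 2 * s ^ 2 + E ^ 2) + 0.2 * E * c ≤ 1 := by
  set M := (1 / 2 + 5 / 8 * Q) ^ 2 with hM
  have hCM : C ^ 2 ≤ M := by
    rw [hM, ← sq_abs C]
    exact pow_le_pow_left₀ (abs_nonneg _) hC 2
  have hM1 : 1 / 4 ≤ M := by nlinarith
  have hF : 0 ≤ M - 0.68 * E ^ 2 * M - 0.64 * M ^ 2 - 0.04 * (E ^ 2) ^ 2 := by
    have hd : Q ^ 2 ≤ 1 - E ^ 2 := by linarith
    have hd1 : 1 - E ^ 2 ≤ 1 := by nlinarith [sq_nonneg E]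
    have hQ2 : Q ^ 2 ≤ 1 := by nlinarith
    generalize hde : 1 - E ^ 2 = d at *
    have he : E ^ 2 = 1 - d := by linarith
    rw [he]
    have k1 : 0 ≤ (d - Q ^ 2) * (0.68 * M + 0.08 - 0.04 * (d + Q ^ 2)) :=
      mul_nonneg (by linarith) (by linarith)
    have k2 : 0.64 * (M - 1 / 4) ^ 2 ≤ Q ^ 2 * (0.68 * M + 0.08 - 0.04 * Q ^ 2) := by
      rw [hM]
      have : 0 ≤ Q ^ 3 := by positivity
      have : 0 ≤ Q ^ 4 := by positivity
      nlinarith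
    nlinarith
  have hA : 0 < 0.04 * E ^ 2 + 0.64 * M := by nlinarith [sq_nonneg E]
  have hG : 0 ≤ 1 - 0.4 * E * c + 0.04 * E ^ 2 * c ^ 2 - 0.64 * M * (1 - c ^ 2) - 0.64 * E ^ 2 := by
    have : 0 ≤ (0.04 * E ^ 2 + 0.64 * M) *
      (1 - 0.4 * E * c + 0.04 * E ^ 2 * c ^ 2 - 0.64 * M * (1 - c ^ 2) - 0.64 * E ^ 2) := by
      have : (0.04 * E ^ 2 + 0.64 * M) *
        (1 - 0.4 * E * c + 0.04 * E ^ 2 * c ^ 2 - 0.64 * M * (1 - c ^ 2) - 0.64 * E ^ 2) =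
        ((0.04 * E ^ 2 + 0.64 * M) * c - 0.2 * E) ^ 2 +
          0.64 * (M - 0.68 * E ^ 2 * M - 0.64 * M ^ 2 - 0.04 * (E ^ 2) ^ 2) := by ring
      rw [this]
      positivity
    exact nonneg_of_mul_nonneg_right this hA
  have hEc : E * c ≤ 1 := by nlinarith [sq_nonneg (E - c), sq_nonneg s, sq_nonneg Q]
  have hs : Real.sqrt (C ^ 2 * s ^ 2 + E ^ 2) ≤ (1 - 0.2 * E * c) / 0.8 := by
    rw [Real.sqrt_le_left (by apply div_nonneg <;> linarith)]
    have h1 : C ^ 2 * s ^ 2 ≤ M * s ^ 2 := mul_le_mul_of_nonneg_right hCM (sq_nonneg s)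
    have h2 : s ^ 2 = 1 - c ^ 2 := by linarith
    rw [h2] at h1 ⊢
    rw [div_pow, le_div_iff₀ (by norm_num)]
    linarith
  rw [le_div_iff₀ (by norm_num)] at hs
  linarith

lemma exp_neg_quad {z : ℝ} (hz : 0 ≤ z) : Real.exp (-z) ≤ 1 - z + z ^ 2 / 2 := by
  have h := Real.quadratic_le_exp_of_nonneg hz
  have h1 : Real.exp (-z) * Real.exp z = 1 := by rw [← Real.exp_add]; simp
  have h2 := Real.exp_pos z
  have h3 : 0 < 1 - z + z ^ 2 / 2 := by nlinarith [sq_nonneg (z - 1)]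
  have h4 : 1 ≤ (1 - z + z ^ 2 / 2) * Real.exp z := by
    nlinarith [mul_le_mul_of_nonneg_left h h3.le, sq_nonneg (z ^ 2)]
  exact le_of_mul_le_mul_right (h1.le.trans h4) h2

lemma cos_le_gauss_nonneg {y : ℝ} (h0 : 0 ≤ y) (h1 : y ≤ π / 2) :
    Real.cos y ≤ Real.exp (-(y ^ 2 / 2)) := by
  have hd : ∀ y : ℝ, HasDerivAt (fun y : ℝ => Real.exp (y ^ 2 / 2) * Real.cos y)
      (Real.exp (y ^ 2 / 2) * (y * Real.cos y - Real.sin y)) y := by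
    intro y
    have h1 : HasDerivAt (fun y : ℝ => y ^ 2 / 2) y y := by
      refine ((hasDerivAt_pow 2 y).div_const 2).congr_deriv ?_
      norm_num
    refine (h1.exp.mul (Real.hasDerivAt_cos y)).congr_deriv ?_
    ring
  have hanti : AntitoneOn (fun y : ℝ => Real.exp (y ^ 2 / 2) * Real.cos y) (Set.Icc 0 (π / 2)) := by
    apply antitoneOn_of_deriv_nonpos (convex_Icc _ _)
    · fun_prop
    · fun_prop
    · intro x hx
      rw [interior_Icc] at hx
      rw [(hd x).deriv]
      have hc : 0 < Real.cos x := Real.cos_pos_of_mem_Ioo ⟨by linarith [hx.1, Real.pi_pos], hx.2⟩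
      have ht := (Real.lt_tan hx.1 hx.2).le
      rw [Real.tan_eq_sin_div_cos, le_div_iff₀ hc] at ht
      exact mul_nonpos_of_nonneg_of_nonpos (Real.exp_pos _).le (by linarith)
  have h := hanti ⟨le_rfl, by positivity⟩ ⟨h0, h1⟩ h0
  simp at h
  rw [Real.exp_neg, ← one_div, le_div_iff₀ (Real.exp_pos _)]
  linarith

lemma cos_le_gauss {y : ℝ} (h : |y| ≤ π / 2) : Real.cos y ≤ Real.exp (-(y ^ 2 / 2)) := by
  have := cos_le_gauss_nonneg (abs_nonneg y) h
  rwa [Real.cos_abs, sq_abs] at this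

lemma arg_bound {s b x : ℝ} (hs : 0 < s) (hb : s * b = π / 2) (hx : x ∈ Set.Icc (-b) b) :
    |s * x| ≤ π / 2 := by
  rw [abs_le, ← hb]
  constructor <;> nlinarith [hx.1, hx.2]

lemma int_nonneg {s b : ℝ} (hs : 0 < s) (hb0 : 0 < b) (hb : s * b = π / 2) :
    0 ≤ ∫ x in (-b)..b, Real.exp (-x ^ 2) * Real.cos (s * x) := by
  apply intervalIntegral.integral_nonneg (by linarith)
  intro x hx
  have := abs_le.1 (arg_bound hs hb hx)
  exact mul_nonneg (Real.exp_pos _).le (Real.cos_nonneg_of_mem_Icc ⟨by linarith, by linarith⟩)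

lemma int_le_gauss {s b : ℝ} (hs : 0 < s) (hb0 : 0 < b) (hb : s * b = π / 2) :
    (∫ x in (-b)..b, Real.exp (-x ^ 2) * Real.cos (s * x)) ≤ √(π / (1 + s ^ 2 / 2)) := by
  have h1 : (∫ x in (-b)..b, Real.exp (-x ^ 2) * Real.cos (s * x)) ≤
      ∫ x in (-b)..b, Real.exp (-(1 + s ^ 2 / 2) * x ^ 2) := by
    apply intervalIntegral.integral_mono_on (by linarith)
    · exact Continuous.intervalIntegrable (by fun_prop) _ _
    · exact Continuous.intervalIntegrable (by fun_prop) _ _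
    · intro x hx
      have h := cos_le_gauss (arg_bound hs hb hx)
      have e : Real.exp (-(1 + s ^ 2 / 2) * x ^ 2) =
          Real.exp (-x ^ 2) * Real.exp (-((s * x) ^ 2 / 2)) := by
        rw [← Real.exp_add]; congr 1; ring
      rw [e]
      exact mul_le_mul_of_nonneg_left h (Real.exp_pos _).le
  rw [← integral_gaussian]
  refine h1.trans ?_
  rw [intervalIntegral.integral_of_le (by linarith)]
  exact MeasureTheory.setIntegral_le_integral (integrable_exp_neg_mul_sq (by positivity))
    (Filter.Eventually.of_forall fun x => (Real.exp_pos _).le)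

lemma int_le_poly {s b : ℝ} (hs : 0 < s) (hb0 : 0 < b) (hb : s * b = π / 2) :
    (∫ x in (-b)..b, Real.exp (-x ^ 2) * Real.cos (s * x)) ≤
      2 / s * (1 - (π ^ 2 / 4 - 2) / s ^ 2 + (π ^ 4 / 32 - 3 * π ^ 2 / 2 + 12) / s ^ 4) := by
  have h1 : (∫ x in (-b)..b, Real.exp (-x ^ 2) * Real.cos (s * x)) ≤
      ∫ x in (-b)..b, (1 - x ^ 2 + x ^ 4 / 2) * Real.cos (s * x) := by
    apply intervalIntegral.integral_mono_on (by linarith)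
    · exact Continuous.intervalIntegrable (by fun_prop) _ _
    · exact Continuous.intervalIntegrable (by fun_prop) _ _
    · intro x hx
      have := abs_le.1 (arg_bound hs hb hx)
      have h2 := exp_neg_quad (sq_nonneg x)
      refine mul_le_mul_of_nonneg_right (h2.trans (le_of_eq (by ring)))
        (Real.cos_nonneg_of_mem_Icc ⟨by linarith, by linarith⟩)
  refine h1.trans (le_of_eq ?_)
  have hd : ∀ x ∈ Set.uIcc (-b) b, HasDerivAt (fun x : ℝ =>
      ((1 - x ^ 2 + x ^ 4 / 2) / s - (-2 + 6 * x ^ 2) / s ^ 3 + 12 / s ^ 5) * Real.sin (s * x)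
      + ((-2 * x + 2 * x ^ 3) / s ^ 2 - 12 * x / s ^ 4) * Real.cos (s * x))
      ((1 - x ^ 2 + x ^ 4 / 2) * Real.cos (s * x)) x := by
    intro x _
    have hl : HasDerivAt (fun x : ℝ => s * x) s x := by
      simpa using (hasDerivAt_id x).const_mul s
    have p1 : HasDerivAt (fun x : ℝ =>
        (1 - x ^ 2 + x ^ 4 / 2) / s - (-2 + 6 * x ^ 2) / s ^ 3 + 12 / s ^ 5)
        ((-2 * x + 2 * x ^ 3) / s - 12 * x / s ^ 3) x := by
      have a2 := hasDerivAt_pow 2 x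
      have a4 := hasDerivAt_pow 4 x
      refine ((((a2.const_sub 1).fun_add (a4.div_const 2)).div_const s).fun_sub
        (((a2.const_mul 6).const_add (-2)).div_const (s ^ 3))).add_const (12 / s ^ 5)
        |>.congr_deriv ?_
      norm_num
      ring
    have p2 : HasDerivAt (fun x : ℝ => (-2 * x + 2 * x ^ 3) / s ^ 2 - 12 * x / s ^ 4)
        ((-2 + 6 * x ^ 2) / s ^ 2 - 12 / s ^ 4) x := by
      have a1 := hasDerivAt_id' x
      have a3 := hasDerivAt_pow 3 x
      refine ((((a1.const_mul (-2)).fun_add (a3.const_mul 2)).div_const (s ^ 2)).fun_sub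
        ((a1.const_mul 12).div_const (s ^ 4))).congr_deriv ?_
      norm_num
      ring
    refine ((p1.fun_mul hl.sin).fun_add (p2.fun_mul hl.cos)).congr_deriv ?_
    field_simp
    ring
  rw [intervalIntegral.integral_eq_sub_of_hasDerivAt hd
    (Continuous.intervalIntegrable (by fun_prop) _ _)]
  have e1 : s * -b = -(π / 2) := by linarith
  have e2 : b = π / (2 * s) := by field_simp; linarith
  rw [hb, e1, Real.sin_neg, Real.cos_neg, Real.sin_pi_div_two, Real.cos_pi_div_two, e2]
  field_simp
  ring

lemma ineqA {w : ℝ} (h0 : 0 ≤ w) (h1 : w ≤ 1) :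
    2 / √(1 + w) ≤ 1 / 2 + 5 / 8 * Real.exp (-(8 / 25 * w)) + Real.exp (-(w / 2)) := by
  have e1 := exp_tangent (y := 8 / 25 * w) (y0 := 0.16) (ρ := 0.852)
    (exp_neg_num (by norm_num) (by norm_num) (by norm_num) (by norm_num)) (by linarith)
  have e2 := exp_tangent (y := w / 2) (y0 := 0.25) (ρ := 0.778)
    (exp_neg_num (by norm_num) (by norm_num) (by norm_num) (by norm_num)) (by linarith)
  have h2 := inv_le_amgm (α := √(1 + w)) (a0 := 1.2) (Real.sqrt_pos.2 (by linarith)) (by norm_num)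
  rw [Real.sq_sqrt (by linarith)] at h2
  have h3 : 2 / √(1 + w) = 2 * (1 / √(1 + w)) := by ring
  have h4 : 1.2 / (1 + w) ≤ 1.2 - 0.6 * w := by
    rw [div_le_iff₀ (by linarith)]
    nlinarith
  rw [h3]
  norm_num at *
  linarith

lemma c1_eq (α : ℝ) : c1T α 1 = (2 / √π) *
    (∫ x in (-bT α 1)..(bT α 1), Real.exp (-x ^ 2) * Real.cos (√2 * α * x))
      - Real.exp (-(α ^ 2 / 2)) := by
  unfold c1T
  have h1 : Real.exp (-(1 - 1) * α ^ 2 / 2) = 1 := by simp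
  have h2 : ∀ x : ℝ, √2 * x * (√1 * α) = √2 * α * x := fun x => by rw [Real.sqrt_one]; ring
  have h3 : -1 * α ^ 2 / 2 = -(α ^ 2 / 2) := by ring
  simp only [h1, h2, h3, one_mul]

lemma c1_bound {α : ℝ} (hα : 0 < α) :
    |c1T α 1| ≤ 1 / 2 + 5 / 8 * Real.exp (-(α ^ 2 / π)) := by
  have hpi := Real.pi_pos
  have hp1 := Real.pi_gt_d6
  have hp2 := Real.pi_lt_d6
  have h2pos : 0 < √2 := by positivity
  have hs : 0 < √2 * α := by positivity
  have hb0 : 0 < bT α 1 := by unfold bT; rw [Real.sqrt_one]; positivity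
  have hb : √2 * α * bT α 1 = π / 2 := by
    unfold bT; rw [Real.sqrt_one]; field_simp
  have hsq : (√2 * α) ^ 2 = 2 * α ^ 2 := by
    rw [mul_pow, Real.sq_sqrt (by norm_num)]
  have hspi : 0 < √π := Real.sqrt_pos.2 hpi
  have hspi2 : √π ^ 2 = π := Real.sq_sqrt hpi.le
  rw [c1_eq]
  have i0 := int_nonneg hs hb0 hb
  have i1 := int_le_gauss hs hb0 hb
  have i2 := int_le_poly hs hb0 hb
  set I := ∫ x in (-bT α 1)..(bT α 1), Real.exp (-x ^ 2) * Real.cos (√2 * α * x)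
  have hI : 0 ≤ 2 / √π * I := by positivity
  have hexp : Real.exp (-(8 / 25 * α ^ 2)) ≤ Real.exp (-(α ^ 2 / π)) := by
    apply Real.exp_le_exp.2
    apply neg_le_neg
    rw [div_le_iff₀ hpi]
    nlinarith [sq_nonneg α]
  have hw : 0 < α ^ 2 := by positivity
  rw [abs_le]
  constructor
  · have : Real.exp (-(α ^ 2 / 2)) ≤ Real.exp (-(α ^ 2 / π)) := by
      apply Real.exp_le_exp.2
      apply neg_le_neg
      apply div_le_div_of_nonneg_left hw.le (by norm_num) (by linarith)
    have h1 : Real.exp (-(α ^ 2 / π)) ≤ 1 :=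
      Real.exp_le_one_iff.2 (neg_nonpos.2 (by positivity))
    linarith
  · rcases le_total (α ^ 2) 1 with h | h
    · have hA := ineqA hw.le h
      have e : 2 / √π * √(π / (1 + (√2 * α) ^ 2 / 2)) = 2 / √(1 + α ^ 2) := by
        rw [hsq, Real.sqrt_div hpi.le, show 1 + 2 * α ^ 2 / 2 = 1 + α ^ 2 by ring]
        field_simp
      have := mul_le_mul_of_nonneg_left i1 (by positivity : 0 ≤ 2 / √π)
      linarith
    · have hB := ineqB hα h
      have e4 : (√2 * α) ^ 4 = 4 * (α ^ 2) ^ 2 := by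
        rw [show (√2 * α) ^ 4 = ((√2 * α) ^ 2) ^ 2 by ring, hsq]; ring
      rw [hsq, e4] at i2
      have k0 : 2 / √π * (2 / (√2 * α)) ≤ 1.5958 / α := by
        have : 2 / √π * (2 / (√2 * α)) = (4 / (√π * √2)) / α := by field_simp; norm_num
        rw [this]
        apply div_le_div_of_nonneg_right _ hα.le
        rw [div_le_iff₀ (by positivity)]
        have hm : √π * √2 = √(π * 2) := (Real.sqrt_mul hpi.le 2).symm
        have : (2.5066 : ℝ) ≤ √π * √2 := by
          rw [hm]
          apply Real.le_sqrt_of_sq_le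
          norm_num
          linarith
        linarith
      have k1 : (1 - (π ^ 2 / 4 - 2) / (2 * α ^ 2) +
          (π ^ 4 / 32 - 3 * π ^ 2 / 2 + 12) / (4 * (α ^ 2) ^ 2)) ≤
          1 - 0.2337 / α ^ 2 + 0.06 / (α ^ 2) ^ 2 := by
        have hq1 : (9.8696 : ℝ) ≤ π ^ 2 := by nlinarith
        have hq2 : π ^ 2 ≤ 9.86961 := by nlinarith
        have j1 : 0.2337 / α ^ 2 ≤ (π ^ 2 / 4 - 2) / (2 * α ^ 2) := by
          rw [div_le_div_iff₀ hw (by positivity)]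
          nlinarith
        have j2 : (π ^ 4 / 32 - 3 * π ^ 2 / 2 + 12) / (4 * (α ^ 2) ^ 2) ≤ 0.06 / (α ^ 2) ^ 2 := by
          rw [div_le_div_iff₀ (by positivity) (by positivity)]
          have : π ^ 4 / 32 - 3 * π ^ 2 / 2 + 12 ≤ 0.24 := by
            rw [show π ^ 4 = (π ^ 2) ^ 2 by ring]
            nlinarith
          have := mul_le_mul_of_nonneg_right this (sq_nonneg (α ^ 2))
          linarith
        linarith
      have k2 : 0 ≤ 1 - 0.2337 / α ^ 2 + 0.06 / (α ^ 2) ^ 2 := by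
        have a1 : 0.2337 / α ^ 2 ≤ 1 := by
          rw [div_le_iff₀ hw]; linarith
        have a2 : 0 ≤ 0.06 / (α ^ 2) ^ 2 := by positivity
        linarith
      have k3 := mul_le_mul_of_nonneg_left i2 (by positivity : 0 ≤ 2 / √π)
      rw [← mul_assoc] at k3
      have k4 := mul_le_mul_of_nonneg_left k1 (by positivity : 0 ≤ 2 / √π * (2 / (√2 * α)))
      have k5 := mul_le_mul_of_nonneg_right k0 k2
      linarith

lemma erf_bound (α : ℝ) :
    erf (α / √2) ^ 2 ≤ 1 - Real.exp (-(α ^ 2 / π)) ^ 2 := by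
  have h := polya (α / √2)
  unfold erf
  rw [mul_pow, div_pow, Real.sq_sqrt Real.pi_pos.le, ← Real.exp_nat_mul]
  rw [div_pow, Real.sq_sqrt (by norm_num : (0:ℝ) ≤ 2)] at h
  have e : ((2 : ℕ) : ℝ) * -(α ^ 2 / π) = -(4 * (α ^ 2 / 2) / π) := by push_cast; ring
  rw [e]
  norm_num at h ⊢
  linarith

/-- At perfect transmission `T = 1` with atomic detection efficiency `η_a = 0.8`, for every
`α > 0` and every `ν`,
`0.8·√(c₁(α,1)²·sin²(2ν) + erf(α/√2)²) + 0.2·erf(α/√2)·cos(2ν) ≤ 1`: no CHSH violation is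
possible with 80% efficient atomic detection, consistent with the required minimum atomic
efficiency of about 0.817. -/
theorem no_two_homodyne_violation_atomic_efficiency_0_8 :
    ∀ α > (0 : ℝ), ∀ ν : ℝ,
      0.8 * Real.sqrt ((c1T α 1) ^ 2 * Real.sin (2 * ν) ^ 2
          + (erf (α / Real.sqrt 2)) ^ 2)
        + 0.2 * erf (α / Real.sqrt 2) * Real.cos (2 * ν) ≤ 1 := by
  intro α hα ν
  exact algebra_final (Real.exp_pos _).le (erf_bound α) (c1_bound hα)
    (Real.sin_sq_add_cos_sq (2 * ν))
end
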